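/- arXiv:2605.10313 — 4 statements merged into one kernel-verified Lean document; each statement's English description precedes it below -/
import Mathlib

section
/- Let L > 0, d ∈ ℕ, p ≥ 1, α ∈ (1/p, 1], and H₁, H₂ > 0. Define K := { f : [0,L] → ℝ^d continuous : ‖f‖_∞ ≤ H₁ and ‖f‖_{α-Höl} ≤ H₂ }, where ‖f‖_∞ := sup_{t∈[0,L]} |f(t)|. Then K is sequentially compact with respect to the p-variation norm ‖·‖_{V^p} := ‖·‖_p + ‖·‖_∞: every sequence (f_n) in K admits a subsequence (f_{n_k}) and a limit f ∈ K such that ‖f_{n_k} − f‖_∞ → 0 and ‖f_{n_k} − f‖_p → 0 as k → ∞. -/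
open Filter

/-- The sup norm `‖f‖_∞ = sup_{t ∈ [0,L]} |f t|` of a path on `[0,L]`. -/
noncomputable def supNorm (d : ℕ) (L : ℝ) (f : ℝ → EuclideanSpace ℝ (Fin d)) : ℝ :=
  sSup ((fun t => ‖f t‖) '' Set.Icc (0 : ℝ) L)

/-- The `p`-variation seminorm
`‖f‖_p = (sup_Π Σ_i |f(t_{i+1}) − f(t_i)|^p)^{1/p}` of a path on `[0,L]`,
the supremum being over all finite increasing sequences in `[0,L]`. -/
noncomputable def pVar (d : ℕ) (L p : ℝ) (f : ℝ → EuclideanSpace ℝ (Fin d)) : ℝ :=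
  (sSup {S : ℝ | ∃ (m : ℕ) (t : Fin (m + 1) → ℝ), StrictMono t ∧
      0 ≤ t 0 ∧ t (Fin.last m) ≤ L ∧
      S = ∑ i : Fin m, ‖f (t i.succ) - f (t i.castSucc)‖ ^ p}) ^ (1 / p)

theorem pVar_nonneg (d : ℕ) (L p : ℝ) (f : ℝ → EuclideanSpace ℝ (Fin d)) :
    0 ≤ pVar d L p f := by
  refine Real.rpow_nonneg (Real.sSup_nonneg ?_) _
  rintro S ⟨m, t, -, -, -, rfl⟩
  positivity

theorem sum_succ_sub_castSucc {m : ℕ} (t : Fin (m + 1) → ℝ) :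
    ∑ i : Fin m, (t i.succ - t i.castSucc) = t (Fin.last m) - t 0 := by
  induction m with
  | zero => simp
  | succ m ih =>
    have h := ih fun i => t i.castSucc
    simp only [Fin.castSucc_zero] at h
    rw [Fin.sum_univ_castSucc, Fin.succ_last]
    simp only [Fin.succ_castSucc]
    rw [h]
    ring

/-- Interpolation between the sup norm and a Hölder bound with exponent `α > 1 / p` controls the
`p`-variation. -/
theorem pVar_le_of_norm_le_of_holder {d : ℕ} {L p α M ε : ℝ} (hL : 0 ≤ L) (hp : 0 < p)
    (hα : 0 < α) (hpα : 1 / α ≤ p) (hM : 0 ≤ M) (hε : 0 ≤ ε)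
    {h : ℝ → EuclideanSpace ℝ (Fin d)} (hsup : ∀ t ∈ Set.Icc (0 : ℝ) L, ‖h t‖ ≤ ε)
    (hhol : ∀ s ∈ Set.Icc (0 : ℝ) L, ∀ t ∈ Set.Icc (0 : ℝ) L,
      ‖h t - h s‖ ≤ M * |t - s| ^ α) :
    pVar d L p h ≤ ((2 * ε) ^ (p - 1 / α) * M ^ (1 / α) * L) ^ (1 / p) := by
  have hincr : ∀ s ∈ Set.Icc (0 : ℝ) L, ∀ t ∈ Set.Icc (0 : ℝ) L, s ≤ t →
      ‖h t - h s‖ ^ p ≤ (2 * ε) ^ (p - 1 / α) * M ^ (1 / α) * (t - s) := by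
    intro s hs t ht hst
    have hts : 0 ≤ t - s := sub_nonneg.2 hst
    have h₁ : ‖h t - h s‖ ≤ 2 * ε :=
      (norm_sub_le _ _).trans (by linarith [hsup s hs, hsup t ht])
    have h₂ : ‖h t - h s‖ ^ (1 / α) ≤ M ^ (1 / α) * (t - s) := by
      calc ‖h t - h s‖ ^ (1 / α) ≤ (M * |t - s| ^ α) ^ (1 / α) :=
            Real.rpow_le_rpow (norm_nonneg _) (hhol s hs t ht) (by positivity)
        _ = M ^ (1 / α) * (t - s) := by
            rw [Real.mul_rpow hM (by positivity), ← Real.rpow_mul (abs_nonneg _),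
              mul_one_div_cancel hα.ne', Real.rpow_one, abs_of_nonneg hts]
    calc ‖h t - h s‖ ^ p = ‖h t - h s‖ ^ (p - 1 / α) * ‖h t - h s‖ ^ (1 / α) := by
          rw [← Real.rpow_add_of_nonneg (norm_nonneg _) (sub_nonneg.2 hpα) (by positivity),
            sub_add_cancel]
      _ ≤ (2 * ε) ^ (p - 1 / α) * (M ^ (1 / α) * (t - s)) :=
          mul_le_mul (Real.rpow_le_rpow (norm_nonneg _) h₁ (sub_nonneg.2 hpα)) h₂
            (by positivity) (by positivity)
      _ = _ := by ring
  refine Real.rpow_le_rpow (Real.sSup_nonneg ?_) (Real.sSup_le ?_ (by positivity)) (by positivity)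
  · rintro S ⟨m, t, -, -, -, rfl⟩
    positivity
  · rintro S ⟨m, t, ht, h0, hlast, rfl⟩
    have hmem : ∀ i, t i ∈ Set.Icc (0 : ℝ) L := fun i =>
      ⟨h0.trans (ht.monotone (Fin.zero_le i)), (ht.monotone (Fin.le_last i)).trans hlast⟩
    calc ∑ i : Fin m, ‖h (t i.succ) - h (t i.castSucc)‖ ^ p
        ≤ ∑ i : Fin m, (2 * ε) ^ (p - 1 / α) * M ^ (1 / α) * (t i.succ - t i.castSucc) :=
          Finset.sum_le_sum fun i _ => hincr _ (hmem _) _ (hmem _)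
            (ht.monotone (Fin.castSucc_lt_succ).le)
      _ = (2 * ε) ^ (p - 1 / α) * M ^ (1 / α) * (t (Fin.last m) - t 0) := by
          rw [← Finset.mul_sum, sum_succ_sub_castSucc]
      _ ≤ (2 * ε) ^ (p - 1 / α) * M ^ (1 / α) * L :=
          mul_le_mul_of_nonneg_left (by linarith) (by positivity)

/-- Sequential form of the Arzelà–Ascoli theorem for uniformly bounded, uniformly Hölder paths. -/
theorem exists_subseq_tendsto_of_holder {d : ℕ} {L α H₁ H₂ : ℝ} (hL : 0 ≤ L) (hα : 0 < α)
    {f : ℕ → ℝ → EuclideanSpace ℝ (Fin d)}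
    (hcont : ∀ n, ContinuousOn (f n) (Set.Icc (0 : ℝ) L))
    (hsup : ∀ n, ∀ t ∈ Set.Icc (0 : ℝ) L, ‖f n t‖ ≤ H₁)
    (hhol : ∀ n, ∀ s ∈ Set.Icc (0 : ℝ) L, ∀ t ∈ Set.Icc (0 : ℝ) L,
      ‖f n t - f n s‖ ≤ H₂ * |t - s| ^ α) :
    ∃ φ : ℕ → ℕ, StrictMono φ ∧ ∃ g : ℝ → EuclideanSpace ℝ (Fin d), Continuous g ∧
      ∃ ε : ℕ → ℝ, Tendsto ε atTop (nhds 0) ∧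
        ∀ k, ∀ t ∈ Set.Icc (0 : ℝ) L, ‖f (φ k) t - g t‖ ≤ ε k := by
  let F : ℕ → BoundedContinuousFunction (Set.Icc (0 : ℝ) L) (EuclideanSpace ℝ (Fin d)) :=
    fun n => BoundedContinuousFunction.mkOfCompact
      ⟨(Set.Icc (0 : ℝ) L).domRestrict (f n), (hcont n).domRestrict⟩
  have hcomp : IsCompact (closure (Set.range F)) := by
    refine BoundedContinuousFunction.arzela_ascoli
      (Metric.closedBall (0 : EuclideanSpace ℝ (Fin d)) H₁) (isCompact_closedBall _ _)
      (Set.range F) ?_ ?_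
    · rintro _ x ⟨n, rfl⟩
      exact mem_closedBall_zero_iff.2 (hsup n x x.2)
    · refine Metric.equicontinuous_of_continuity_modulus (fun r => H₂ * r ^ α) ?_ _ ?_
      · have h : Tendsto (fun r : ℝ => r ^ α) (nhds 0) (nhds ((0 : ℝ) ^ α)) :=
          (Real.continuousAt_rpow_const 0 α (Or.inr hα.le)).tendsto
        simpa [Real.zero_rpow hα.ne'] using h.const_mul H₂
      · rintro x y ⟨_, n, rfl⟩
        rw [dist_comm, dist_eq_norm, dist_comm, Subtype.dist_eq, Real.dist_eq]
        exact hhol n x x.2 y y.2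
  obtain ⟨G, -, φ, hφ, hG⟩ := hcomp.tendsto_subseq fun n => subset_closure (Set.mem_range_self n)
  refine ⟨φ, hφ, Set.IccExtend hL G, G.continuous.Icc_extend', fun k => dist (F (φ k)) G,
    tendsto_iff_dist_tendsto_zero.1 hG, fun k t ht => ?_⟩
  rw [Set.IccExtend_of_mem hL _ ht, ← dist_eq_norm]
  exact BoundedContinuousFunction.dist_coe_le_dist (f := F (φ k)) (g := G) ⟨t, ht⟩

/-- Compactness of Hölder balls in `p`-variation norm: for `p ≥ 1`,
`α ∈ (1/p, 1]` and `H₁, H₂ > 0`, the set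
`K = {f : [0,L] → ℝ^d continuous : ‖f‖_∞ ≤ H₁, ‖f‖_{α-Höl} ≤ H₂}` is
sequentially compact for `‖·‖_{V^p} = ‖·‖_p + ‖·‖_∞`: every sequence in `K`
has a subsequence converging to some `f ∈ K` in both sup norm and
`p`-variation seminorm. -/
theorem stmt1 (d : ℕ) (L : ℝ) (hL : 0 < L) (p α H₁ H₂ : ℝ)
    (hp : 1 ≤ p) (hα : α ∈ Set.Ioc (1 / p) 1) (hH₁ : 0 < H₁) (hH₂ : 0 < H₂)
    (K : Set (ℝ → EuclideanSpace ℝ (Fin d)))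
    (hK : K = {f | ContinuousOn f (Set.Icc (0 : ℝ) L) ∧
        (∀ t ∈ Set.Icc (0 : ℝ) L, ‖f t‖ ≤ H₁) ∧
        (∀ s ∈ Set.Icc (0 : ℝ) L, ∀ t ∈ Set.Icc (0 : ℝ) L,
          ‖f t - f s‖ ≤ H₂ * |t - s| ^ α)}) :
    ∀ f : ℕ → (ℝ → EuclideanSpace ℝ (Fin d)), (∀ n, f n ∈ K) →
      ∃ (φ : ℕ → ℕ), StrictMono φ ∧ ∃ g ∈ K,
        Tendsto (fun k => supNorm d L (f (φ k) - g)) atTop (nhds 0) ∧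
        Tendsto (fun k => pVar d L p (f (φ k) - g)) atTop (nhds 0) := by
  intro f hf
  subst hK
  have hp0 : 0 < p := by linarith
  have hα0 : 0 < α := lt_trans (by positivity) hα.1
  have hpα : 1 / α < p := (one_div_lt hp0 hα0).1 hα.1
  obtain ⟨φ, hφ, g, hgc, ε, hε, hfg⟩ := exists_subseq_tendsto_of_holder hL.le hα0
    (fun n => (hf n).1) (fun n => (hf n).2.1) (fun n => (hf n).2.2)
  have hε0 : ∀ k, 0 ≤ ε k := fun k => (norm_nonneg _).trans (hfg k 0 ⟨le_rfl, hL.le⟩)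
  have hlim : ∀ t ∈ Set.Icc (0 : ℝ) L, Tendsto (fun k => f (φ k) t) atTop (nhds (g t)) :=
    fun t ht => tendsto_iff_norm_sub_tendsto_zero.2
      (squeeze_zero (fun _ => norm_nonneg _) (fun k => hfg k t ht) hε)
  have hghol : ∀ s ∈ Set.Icc (0 : ℝ) L, ∀ t ∈ Set.Icc (0 : ℝ) L,
      ‖g t - g s‖ ≤ H₂ * |t - s| ^ α := fun s hs t ht =>
    le_of_tendsto' ((hlim t ht).sub (hlim s hs)).norm fun k => (hf (φ k)).2.2 s hs t ht
  refine ⟨φ, hφ, g, ⟨hgc.continuousOn, fun t ht =>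
    le_of_tendsto' (hlim t ht).norm fun k => (hf (φ k)).2.1 t ht, hghol⟩, ?_, ?_⟩
  · refine squeeze_zero (fun k => Real.sSup_nonneg ?_) (fun k => Real.sSup_le ?_ (hε0 k)) hε
    · rintro _ ⟨t, -, rfl⟩
      exact norm_nonneg _
    · rintro _ ⟨t, ht, rfl⟩
      exact hfg k t ht
  · refine squeeze_zero (fun k => pVar_nonneg _ _ _ _)
      (fun k => pVar_le_of_norm_le_of_holder (M := 2 * H₂) hL.le hp0 hα0 hpα.le (by positivity)
        (hε0 k) (hfg k) fun s hs t ht => ?_) ?_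
    · calc ‖(f (φ k) - g) t - (f (φ k) - g) s‖
          = ‖(f (φ k) t - f (φ k) s) - (g t - g s)‖ := by
            simp only [Pi.sub_apply]
            congr 1
            abel
        _ ≤ H₂ * |t - s| ^ α + H₂ * |t - s| ^ α :=
            (norm_sub_le _ _).trans (add_le_add ((hf (φ k)).2.2 s hs t ht) (hghol s hs t ht))
        _ = 2 * H₂ * |t - s| ^ α := by ring
    · have h := ((((hε.const_mul 2).rpow_const (p := p - 1 / α)
        (Or.inr (sub_pos.2 hpα).le)).mul_const ((2 * H₂) ^ (1 / α))).mul_const L).rpow_const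
        (p := 1 / p) (Or.inr (by positivity))
      rwa [mul_zero, Real.zero_rpow (sub_pos.2 hpα).ne', zero_mul, zero_mul,
        Real.zero_rpow (by positivity)] at h
end

section
/- Let (Ω, F, P) be a probability space with a filtration (F_t)_{t≥0} indexed by ℕ, and let (x_t)_{t=1}^T be an ℝ^d-valued stochastic process with x_t measurable with respect to F_t and |x_t| ≤ B almost surely for all t, where B > 0. Assume there exists ρ > 0 such that for every t ≥ 1, (1/t) Σ_{s=1}^t E[x_s x_sᵀ | F_{s−1}] ⪰ ρ I almost surely (in the positive semidefinite order). Fix λ > 0 and δ ∈ (0,1), and set α := log(dT/δ) and T₀ := ⌈((B²√(2α) + B√(2B²α + 8ρα/3))/ρ)²⌉. Then with probability at least 1 − δ, for every t with T₀ ≤ t ≤ T, the smallest eigenvalue satisfies λ_min(λI + Σ_{s=1}^t x_s x_sᵀ) ≥ λ + ρt/2. -/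
open MeasureTheory Matrix

/-- The outer product `x xᵀ` of a vector `x ∈ ℝ^d`. -/
def outerProd {d : ℕ} (x : EuclideanSpace ℝ (Fin d)) : Matrix (Fin d) (Fin d) ℝ :=
  Matrix.of fun i j => x i * x j

/-- The entrywise conditional expectation of a matrix-valued random variable. -/
noncomputable def matCondexp {Ω : Type*} {m0 : MeasurableSpace Ω}
    (μ : Measure Ω) (m : MeasurableSpace Ω) {d : ℕ}
    (F : Ω → Matrix (Fin d) (Fin d) ℝ) : Ω → Matrix (Fin d) (Fin d) ℝ :=
  fun ω => Matrix.of fun i j => (μ[fun ω' => F ω' i j | m]) ω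

/-- The chord bound `q ^ z ≤ 1 - (1 - q) z` on the unit interval. -/
lemma exp_log_mul_le {q z : ℝ} (hq : 0 < q) (hz : z ∈ Set.Icc (0 : ℝ) 1) :
    Real.exp (Real.log q * z) ≤ 1 - (1 - q) * z := by
  have h := rpow_one_add_le_one_add_mul_self (s := q - 1) (by linarith) hz.1 hz.2
  rw [add_sub_cancel, Real.rpow_def_of_pos hq] at h
  linarith

lemma condExp_mem_Icc {Ω : Type*} {m m0 : MeasurableSpace Ω} {μ : Measure Ω}
    [IsProbabilityMeasure μ] (hm : m ≤ m0) {Z : Ω → ℝ} (hZ : Integrable Z μ)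
    (hZ01 : ∀ᵐ ω ∂μ, Z ω ∈ Set.Icc (0 : ℝ) 1) :
    ∀ᵐ ω ∂μ, (μ[Z | m]) ω ∈ Set.Icc (0 : ℝ) 1 := by
  have h0 : 0 ≤ᵐ[μ] μ[Z | m] := condExp_nonneg (hZ01.mono fun ω h => h.1)
  have h1 : μ[Z | m] ≤ᵐ[μ] μ[fun _ => (1 : ℝ) | m] :=
    condExp_mono hZ (integrable_const 1) (hZ01.mono fun ω h => h.2)
  rw [condExp_const hm] at h1
  filter_upwards [h0, h1] with ω a b using ⟨a, b⟩

lemma integrable_of_mem_Icc {Ω : Type*} {m0 : MeasurableSpace Ω} {μ : Measure Ω}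
    [IsFiniteMeasure μ] {Z : Ω → ℝ} (hZ : AEStronglyMeasurable Z μ) {C : ℝ}
    (hZC : ∀ᵐ ω ∂μ, Z ω ∈ Set.Icc (0 : ℝ) C) : Integrable Z μ :=
  Integrable.of_bound hZ C (hZC.mono fun ω h => by rw [Real.norm_of_nonneg h.1]; exact h.2)

/-- One step of the exponential supermartingale for the lower tail of `[0, 1]`-valued variables. -/
lemma integral_mul_exp_le {Ω : Type*} {m m0 : MeasurableSpace Ω} {μ : Measure Ω}
    [IsProbabilityMeasure μ] (hm : m ≤ m0) {G Z : Ω → ℝ} (hG : StronglyMeasurable[m] G)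
    {C : ℝ} (hGC : ∀ᵐ ω ∂μ, G ω ∈ Set.Icc 0 C) (hZ : AEStronglyMeasurable Z μ)
    (hZ01 : ∀ᵐ ω ∂μ, Z ω ∈ Set.Icc (0 : ℝ) 1) {q : ℝ} (hq0 : 0 < q) :
    ∫ ω, G ω * Real.exp (Real.log q * Z ω + (1 - q) * (μ[Z | m]) ω) ∂μ ≤ ∫ ω, G ω ∂μ := by
  have hZi := integrable_of_mem_Icc hZ hZ01
  have hp := condExp_mem_Icc hm hZi hZ01
  set p := μ[Z | m] with hpdef
  have hpm : StronglyMeasurable[m] p := stronglyMeasurable_condExp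
  set H : Ω → ℝ := fun ω => G ω * Real.exp ((1 - q) * p ω) with hH
  have hHm : StronglyMeasurable[m] H :=
    hG.mul (Real.continuous_exp.comp_stronglyMeasurable (hpm.const_mul _))
  have hHb : ∀ᵐ ω ∂μ, H ω ∈ Set.Icc 0 (C * Real.exp 1) := by
    filter_upwards [hGC, hp] with ω a b
    refine ⟨mul_nonneg a.1 (Real.exp_pos _).le, ?_⟩
    refine mul_le_mul a.2 (Real.exp_le_exp.2 ?_) (Real.exp_pos _).le (a.1.trans a.2)
    nlinarith [b.1, b.2]
  have hHi : Integrable H μ := integrable_of_mem_Icc (hHm.mono hm).aestronglyMeasurable hHb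
  have hHn : ∀ᵐ ω ∂μ, ‖H ω‖ ≤ C * Real.exp 1 :=
    hHb.mono fun ω h => by rw [Real.norm_of_nonneg h.1]; exact h.2
  have hHZ : Integrable (fun ω => H ω * Z ω) μ :=
    hZi.bdd_mul (hHm.mono hm).aestronglyMeasurable hHn
  have hHp : Integrable (fun ω => H ω * p ω) μ :=
    integrable_condExp.bdd_mul (hHm.mono hm).aestronglyMeasurable hHn
  have hGi : Integrable G μ := integrable_of_mem_Icc (hG.mono hm).aestronglyMeasurable hGC
  have hpull : ∫ ω, H ω * Z ω ∂μ = ∫ ω, H ω * p ω ∂μ := by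
    have h := condExp_stronglyMeasurable_mul_of_bound hm hHm hZi _ hHn
    calc ∫ ω, H ω * Z ω ∂μ = ∫ ω, (μ[H * Z | m]) ω ∂μ := (integral_condExp hm).symm
      _ = ∫ ω, H ω * p ω ∂μ := integral_congr_ae h
  calc ∫ ω, G ω * Real.exp (Real.log q * Z ω + (1 - q) * p ω) ∂μ
      ≤ ∫ ω, (H ω - (1 - q) * (H ω * Z ω)) ∂μ := by
        refine integral_mono_of_nonneg ?_ (hHi.sub (hHZ.const_mul _)) ?_
        · filter_upwards [hGC] with ω a using mul_nonneg a.1 (Real.exp_pos _).le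
        · filter_upwards [hHb, hZ01] with ω a b
          have := mul_le_mul_of_nonneg_left (exp_log_mul_le hq0 b) a.1
          simp only [hH, Real.exp_add] at this ⊢
          linarith
    _ = ∫ ω, (H ω - (1 - q) * (H ω * p ω)) ∂μ := by
        rw [integral_sub hHi (hHZ.const_mul _), integral_sub hHi (hHp.const_mul _),
          integral_const_mul, integral_const_mul, hpull]
    _ ≤ ∫ ω, G ω ∂μ := by
        refine integral_mono_ae (hHi.sub (hHp.const_mul _)) hGi ?_
        filter_upwards [hGC, hHb] with ω a b
        have h1 : 1 - (1 - q) * p ω ≤ Real.exp (-((1 - q) * p ω)) := by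
          linarith [Real.add_one_le_exp (-((1 - q) * p ω))]
        have h2 := mul_le_mul_of_nonneg_left h1 b.1
        have h3 : H ω * Real.exp (-((1 - q) * p ω)) = G ω := by
          simp only [hH]
          rw [mul_assoc, ← Real.exp_add, add_neg_cancel, Real.exp_zero, mul_one]
        linarith

/-- The exponential process of the lower Chernoff bound is bounded, with integral at most `1`. -/
lemma exp_sum_bounds {Ω : Type*} {m0 : MeasurableSpace Ω} {μ : Measure Ω}
    [IsProbabilityMeasure μ] (ℱ : Filtration ℕ m0) {Z : ℕ → Ω → ℝ} {q : ℝ} (hq0 : 0 < q)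
    (hq1 : q < 1) (n : ℕ) (hZ : ∀ s ∈ Finset.Icc 1 n, StronglyMeasurable[ℱ s] (Z s))
    (hZ01 : ∀ s ∈ Finset.Icc 1 n, ∀ᵐ ω ∂μ, Z s ω ∈ Set.Icc (0 : ℝ) 1) :
    (∀ᵐ ω ∂μ, Real.exp (∑ s ∈ Finset.Icc 1 n,
      (Real.log q * Z s ω + (1 - q) * (μ[Z s | ℱ (s - 1)]) ω)) ∈ Set.Icc 0 (Real.exp n)) ∧
    StronglyMeasurable[ℱ n] (fun ω => Real.exp (∑ s ∈ Finset.Icc 1 n,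
      (Real.log q * Z s ω + (1 - q) * (μ[Z s | ℱ (s - 1)]) ω))) ∧
    ∫ ω, Real.exp (∑ s ∈ Finset.Icc 1 n,
      (Real.log q * Z s ω + (1 - q) * (μ[Z s | ℱ (s - 1)]) ω)) ∂μ ≤ 1 := by
  induction n with
  | zero =>
    refine ⟨?_, ?_, ?_⟩
    · simp
    · simpa using stronglyMeasurable_const
    · simp
  | succ n ih =>
    have hsub : ∀ s ∈ Finset.Icc 1 n, s ∈ Finset.Icc 1 (n + 1) := fun s hs => by
      simp only [Finset.mem_Icc] at hs ⊢; omega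
    obtain ⟨ihb, ihm, ihi⟩ := ih (fun s hs => hZ s (hsub s hs)) (fun s hs => hZ01 s (hsub s hs))
    have hn : n + 1 ∈ Finset.Icc 1 (n + 1) := by simp
    have hZn := hZ _ hn
    have hZae : AEStronglyMeasurable (Z (n + 1)) μ := (hZn.mono (ℱ.le _)).aestronglyMeasurable
    have hp := condExp_mem_Icc (ℱ.le n) (integrable_of_mem_Icc hZae (hZ01 _ hn)) (hZ01 _ hn)
    have hsplit : ∀ ω, Real.exp (∑ s ∈ Finset.Icc 1 (n + 1),
        (Real.log q * Z s ω + (1 - q) * (μ[Z s | ℱ (s - 1)]) ω)) =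
        Real.exp (∑ s ∈ Finset.Icc 1 n,
          (Real.log q * Z s ω + (1 - q) * (μ[Z s | ℱ (s - 1)]) ω)) *
        Real.exp (Real.log q * Z (n + 1) ω + (1 - q) * (μ[Z (n + 1) | ℱ n]) ω) := fun ω => by
      rw [Finset.sum_Icc_succ_top (by omega), Real.exp_add, Nat.add_sub_cancel]
    simp only [hsplit]
    refine ⟨?_, ?_, ?_⟩
    · filter_upwards [ihb, hp, hZ01 _ hn] with ω a b c
      refine ⟨by positivity, ?_⟩
      rw [Nat.cast_succ, Real.exp_add (n : ℝ) 1]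
      refine mul_le_mul a.2 (Real.exp_le_exp.2 ?_) (Real.exp_pos _).le (Real.exp_pos _).le
      nlinarith [b.1, b.2, c.1, Real.log_neg hq0 hq1]
    · refine (ihm.mono (ℱ.mono n.le_succ)).mul (Real.continuous_exp.comp_stronglyMeasurable ?_)
      exact (hZn.const_mul _).add
        ((stronglyMeasurable_condExp.mono (ℱ.mono n.le_succ)).const_mul _)
    · exact (integral_mul_exp_le (ℱ.le n) ihm ihb hZae (hZ01 _ hn) hq0).trans ihi

/-- Lower-tail Chernoff bound for adapted `[0, 1]`-valued variables: the sum is unlikely to be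
below `q a` while the sum of the conditional means is at least `a`. -/
lemma measure_sum_le_of_condExp_sum_ge {Ω : Type*} {m0 : MeasurableSpace Ω} {μ : Measure Ω}
    [IsProbabilityMeasure μ] (ℱ : Filtration ℕ m0) {Z : ℕ → Ω → ℝ} {q : ℝ} (hq0 : 0 < q)
    (hq1 : q < 1) (n : ℕ) (hZ : ∀ s ∈ Finset.Icc 1 n, StronglyMeasurable[ℱ s] (Z s))
    (hZ01 : ∀ s ∈ Finset.Icc 1 n, ∀ᵐ ω ∂μ, Z s ω ∈ Set.Icc (0 : ℝ) 1) (a : ℝ)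
    (ha : ∀ᵐ ω ∂μ, a ≤ ∑ s ∈ Finset.Icc 1 n, (μ[Z s | ℱ (s - 1)]) ω) :
    μ {ω | ∑ s ∈ Finset.Icc 1 n, Z s ω ≤ q * a} ≤
      ENNReal.ofReal (Real.exp (-(a * (q * Real.log q + 1 - q)))) := by
  obtain ⟨hb, hm, hi⟩ := exp_sum_bounds ℱ hq0 hq1 n hZ hZ01
  set M : Ω → ℝ := fun ω => Real.exp (∑ s ∈ Finset.Icc 1 n,
      (Real.log q * Z s ω + (1 - q) * (μ[Z s | ℱ (s - 1)]) ω)) with hM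
  have hMi : Integrable M μ := integrable_of_mem_Icc (hm.mono (ℱ.le n)).aestronglyMeasurable hb
  set ε := Real.exp (a * (q * Real.log q + 1 - q)) with hε
  have hmk := mul_meas_ge_le_integral_of_nonneg (hb.mono fun ω h => h.1) hMi ε
  have hle : μ {ω | ∑ s ∈ Finset.Icc 1 n, Z s ω ≤ q * a} ≤ μ {ω | ε ≤ M ω} := by
    refine measure_mono_ae ?_
    filter_upwards [ha] with ω h (hω : ∑ s ∈ Finset.Icc 1 n, Z s ω ≤ q * a)
    refine Real.exp_le_exp.2 ?_
    rw [Finset.sum_add_distrib, ← Finset.mul_sum, ← Finset.mul_sum]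
    nlinarith [Real.log_neg hq0 hq1]
  refine hle.trans ?_
  rw [← ENNReal.ofReal_toReal (measure_ne_top μ {ω | ε ≤ M ω})]
  refine ENNReal.ofReal_le_ofReal ?_
  rw [Real.exp_neg, ← hε]
  exact (le_inv_mul_iff₀ (Real.exp_pos _)).2 (hmk.trans hi) |>.trans_eq (mul_one _)

/-- If `u` is within relative distance `η` of `v`, up to scaling `v`, then a small value of the
Gram form at `v` forces a small value at `u`. -/
lemma sum_inner_sq_le_of_near {d : ℕ} (n : ℕ) (x : ℕ → EuclideanSpace ℝ (Fin d)) {B ρ : ℝ}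
    (hB : ∀ s ∈ Finset.Icc 1 n, ‖x s‖ ≤ B) {u v : EuclideanSpace ℝ (Fin d)} (hv : v ≠ 0)
    (huv : ‖u - v‖ ^ 2 * B ^ 2 ≤ 1 / 2500 * ρ * ‖u‖ ^ 2)
    (hvx : ∑ s ∈ Finset.Icc 1 n, inner ℝ v (x s) ^ 2 ≤ ρ * n / 2 * ‖v‖ ^ 2) :
    ∑ s ∈ Finset.Icc 1 n, inner ℝ u (x s) ^ 2 ≤ 0.529 * (ρ * n * ‖u‖ ^ 2) := by
  have hv2 : 0 < ‖v‖ ^ 2 := by positivity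
  have hρ : 0 ≤ ρ * n := by
    have h := (Finset.sum_nonneg fun s _ => sq_nonneg (inner ℝ v (x s))).trans hvx
    have := nonneg_of_mul_nonneg_left h hv2
    linarith
  set a : ℝ := inner ℝ u v / ‖v‖ ^ 2 with ha
  have hav : a * ‖v‖ ^ 2 = inner ℝ u v := by rw [ha]; field_simp
  have hdist : ‖u - a • v‖ ^ 2 = ‖u‖ ^ 2 - a ^ 2 * ‖v‖ ^ 2 := by
    rw [norm_sub_sq_real, inner_smul_right, norm_smul, mul_pow, Real.norm_eq_abs, sq_abs, ← hav]
    ring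
  have hle : ‖u - a • v‖ ^ 2 ≤ ‖u - v‖ ^ 2 := by
    rw [hdist, norm_sub_sq_real, ← hav]
    nlinarith [mul_nonneg hv2.le (sq_nonneg (a - 1))]
  have hproj : a ^ 2 * ‖v‖ ^ 2 ≤ ‖u‖ ^ 2 := by linarith [sq_nonneg ‖u - a • v‖]
  have hterm : ∀ s ∈ Finset.Icc 1 n, inner ℝ u (x s) ^ 2 ≤
      1.028 * a ^ 2 * inner ℝ v (x s) ^ 2 + (1 + 250 / 7) * (‖u - v‖ ^ 2 * B ^ 2) := fun s hs => by
    have h1 : inner ℝ u (x s) = a * inner ℝ v (x s) + inner ℝ (u - a • v) (x s) := by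
      rw [inner_sub_left, inner_smul_left]; simp
    have h2 : inner ℝ (u - a • v) (x s) ^ 2 ≤ ‖u - v‖ ^ 2 * B ^ 2 := by
      have h3 := abs_real_inner_le_norm (u - a • v) (x s)
      calc inner ℝ (u - a • v) (x s) ^ 2 = |inner ℝ (u - a • v) (x s)| ^ 2 := (sq_abs _).symm
        _ ≤ (‖u - a • v‖ * ‖x s‖) ^ 2 := by gcongr
        _ = ‖u - a • v‖ ^ 2 * ‖x s‖ ^ 2 := mul_pow _ _ _
        _ ≤ ‖u - v‖ ^ 2 * B ^ 2 := by gcongr; exact hB s hs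
    rw [h1]
    nlinarith [sq_nonneg (0.028 * (a * inner ℝ v (x s)) - inner ℝ (u - a • v) (x s))]
  calc ∑ s ∈ Finset.Icc 1 n, inner ℝ u (x s) ^ 2
      ≤ ∑ s ∈ Finset.Icc 1 n, (1.028 * a ^ 2 * inner ℝ v (x s) ^ 2 +
          (1 + 250 / 7) * (‖u - v‖ ^ 2 * B ^ 2)) := Finset.sum_le_sum hterm
    _ = 1.028 * (a ^ 2 * ∑ s ∈ Finset.Icc 1 n, inner ℝ v (x s) ^ 2) +
          (1 + 250 / 7) * (n * (‖u - v‖ ^ 2 * B ^ 2)) := by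
        rw [Finset.sum_add_distrib, ← Finset.mul_sum]
        simp
        ring
    _ ≤ 1.028 * (a ^ 2 * (ρ * n / 2 * ‖v‖ ^ 2)) +
          (1 + 250 / 7) * (n * (1 / 2500 * ρ * ‖u‖ ^ 2)) := by gcongr
    _ = 0.514 * (ρ * n * (a ^ 2 * ‖v‖ ^ 2)) + (1 + 250 / 7) / 2500 * (ρ * n * ‖u‖ ^ 2) := by ring
    _ ≤ 0.514 * (ρ * n * ‖u‖ ^ 2) + (1 + 250 / 7) / 2500 * (ρ * n * ‖u‖ ^ 2) := by gcongr
    _ ≤ 0.529 * (ρ * n * ‖u‖ ^ 2) := by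
        have : 0 ≤ ρ * n * ‖u‖ ^ 2 := by positivity
        linarith

/-- Grid points of mesh `1 / M` in the unit cube approximate every direction. -/
lemma exists_grid_net (d M : ℕ) (hM : 0 < M) :
    ∃ G : Finset (EuclideanSpace ℝ (Fin d)), G.card ≤ (2 * M + 1) ^ d ∧
      ∀ v : EuclideanSpace ℝ (Fin d), v ≠ 0 → ∃ u ∈ G, u ≠ 0 ∧ ∃ a : ℝ, a ≠ 0 ∧
        ‖u - a • v‖ ^ 2 ≤ d / (4 * M ^ 2) * ‖u‖ ^ 2 := by
  classical
  have hM' : (0 : ℝ) < M := by exact_mod_cast hM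
  refine ⟨(Fintype.piFinset fun _ : Fin d => Finset.Icc (-M : ℤ) M).image
    fun k => WithLp.toLp 2 fun i => (k i : ℝ) / M, ?_, fun v hv => ?_⟩
  · refine Finset.card_image_le.trans ?_
    rw [Fintype.card_piFinset]
    simp only [Finset.prod_const, Finset.card_univ, Fintype.card_fin, Int.card_Icc]
    refine Nat.pow_le_pow_left ?_ d
    omega
  · have hne : ∃ i, v i ≠ 0 := by
      by_contra! h
      exact hv (by ext i; simpa using h i)
    obtain ⟨j, hj⟩ := hne
    obtain ⟨i₀, -, hi₀⟩ := Finset.exists_max_image Finset.univ (fun i => |v i|) ⟨j, by simp⟩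
    have hpos : 0 < |v i₀| := (abs_pos.2 hj).trans_le (hi₀ j (by simp))
    set a : ℝ := |v i₀|⁻¹ with ha
    have ha0 : 0 < a := inv_pos.2 hpos
    have hbd : ∀ i, |a * v i| ≤ 1 := fun i => by
      rw [abs_mul, abs_of_pos ha0, ha, inv_mul_le_one₀ hpos]
      exact hi₀ i (by simp)
    have hone : |a * v i₀| = 1 := by
      rw [abs_mul, abs_of_pos ha0, ha, inv_mul_cancel₀ hpos.ne']
    set k : Fin d → ℤ := fun i => round (M * (a * v i)) with hk
    have hround : ∀ i, |(k i : ℝ) / M - a * v i| ≤ 1 / (2 * M) := fun i => by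
      have h := abs_sub_round (M * (a * v i) : ℝ)
      have h2 : (k i : ℝ) / M - a * v i = -((M * (a * v i) - round (M * (a * v i))) / M) := by
        simp only [hk]; field_simp; ring
      rw [h2, abs_neg, abs_div, abs_of_pos hM', div_le_div_iff₀ hM' (by positivity)]
      nlinarith
    have hk0 : |(k i₀ : ℝ) / M| = 1 := by
      rcases (abs_eq (zero_le_one (α := ℝ))).1 hone with h | h
      · simp [hk, h, hM'.ne']
      · have : round (-(M : ℝ)) = -(M : ℤ) := by
          exact_mod_cast round_intCast (α := ℝ) (-(M : ℤ))
        simp [hk, h, this, hM'.ne']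
    set u : EuclideanSpace ℝ (Fin d) := WithLp.toLp 2 fun i => (k i : ℝ) / M with hu
    have hui : ∀ i, u i = (k i : ℝ) / M := fun i => rfl
    have hu1 : 1 ≤ ‖u‖ ^ 2 := by
      rw [EuclideanSpace.real_norm_sq_eq]
      calc (1 : ℝ) = u i₀ ^ 2 := by rw [hui, ← sq_abs, hk0, one_pow]
        _ ≤ _ := Finset.single_le_sum (f := fun i => u i ^ 2) (fun i _ => sq_nonneg _) (by simp)
    refine ⟨u, Finset.mem_image_of_mem _ ?_, ?_, a, ha0.ne', ?_⟩
    · rw [Fintype.mem_piFinset]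
      intro i
      have h := abs_le.1 (hbd i)
      rw [Finset.mem_Icc]
      have h1 := round_le_add_half (M * (a * v i) : ℝ)
      have h2 := sub_half_lt_round (M * (a * v i) : ℝ)
      constructor
      · have : (-(M : ℤ) - 1 : ℝ) < (k i : ℝ) := by
          simp only [hk]; push_cast; nlinarith
        have : -(M : ℤ) - 1 < k i := by exact_mod_cast this
        omega
      · have : (k i : ℝ) < ((M : ℤ) + 1 : ℝ) := by
          simp only [hk]; push_cast; nlinarith
        have : k i < (M : ℤ) + 1 := by exact_mod_cast this
        omega
    · rintro h
      rw [h] at hu1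
      simp at hu1
      linarith
    · calc ‖u - a • v‖ ^ 2 = ∑ i, ((k i : ℝ) / M - a * v i) ^ 2 := by
            rw [EuclideanSpace.real_norm_sq_eq]; rfl
        _ ≤ ∑ i : Fin d, (1 / (2 * M : ℝ)) ^ 2 := by
            refine Finset.sum_le_sum fun i _ => ?_
            rw [← sq_abs]
            gcongr
            exact hround i
        _ = d / (4 * M ^ 2) * 1 := by
            simp
            field_simp
            norm_num
        _ ≤ d / (4 * M ^ 2) * ‖u‖ ^ 2 := by gcongr

/-- In dimension one a single vector approximates every direction. -/
lemma exists_net_one : ∃ u : EuclideanSpace ℝ (Fin 1), u ≠ 0 ∧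
    ∀ v : EuclideanSpace ℝ (Fin 1), v ≠ 0 → ∃ a : ℝ, a ≠ 0 ∧ u - a • v = 0 := by
  refine ⟨EuclideanSpace.single 0 1, by simp, fun v hv => ?_⟩
  have h0 : v 0 ≠ 0 := fun h => hv (by ext i; rw [Subsingleton.elim i 0]; simpa using h)
  refine ⟨(v 0)⁻¹, inv_ne_zero h0, ?_⟩
  ext i
  rw [Subsingleton.elim i 0]
  simp [h0]

lemma chernoff_rate_bound : (0.134 : ℝ) ≤ 0.529 * Real.log 0.529 + 1 - 0.529 := by
  have h1 := Real.le_log_one_add_of_nonneg (x := 0.058) (by norm_num)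
  have h2 : Real.log 0.529 = Real.log (1 + 0.058) - Real.log 2 := by
    rw [← Real.log_div (by norm_num) (by norm_num)]
    norm_num
  have h3 := Real.log_two_lt_d9
  rw [h2]
  norm_num at h1 h3 ⊢
  linarith

lemma burn_in_lower_bound {B ρ α : ℝ} (hB : 0 < B) (hρ : 0 < ρ) (hρB : ρ ≤ B ^ 2) (hα : 0 ≤ α) :
    B ^ 2 / ρ * (α * (8 * (B ^ 2 / ρ) + 4.16)) ≤
      ((B ^ 2 * Real.sqrt (2 * α) + B * Real.sqrt (2 * B ^ 2 * α + 8 * ρ * α / 3)) / ρ) ^ 2 := by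
  set a := B ^ 2 * Real.sqrt (2 * α) with ha
  set b := B * Real.sqrt (2 * B ^ 2 * α + 8 * ρ * α / 3) with hb
  have ha0 : 0 ≤ a := by positivity
  have hb0 : 0 ≤ b := by positivity
  have ha2 : a ^ 2 = 2 * α * B ^ 4 := by
    rw [ha, mul_pow, Real.sq_sqrt (by positivity)]; ring
  have hb2 : b ^ 2 = 2 * α * B ^ 4 + 8 * ρ * α / 3 * B ^ 2 := by
    rw [hb, mul_pow, Real.sq_sqrt (by positivity)]; ring
  have hab : 2 * α * B ^ 4 + 4 / 5 * (ρ * α * B ^ 2) ≤ a * b := by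
    refine le_of_sq_le_sq ?_ (by positivity)
    rw [mul_pow, ha2, hb2]
    have h : 0 ≤ α ^ 2 * B ^ 4 * ρ * (B ^ 2 - ρ) :=
      mul_nonneg (by positivity) (sub_nonneg.2 hρB)
    have h' : 0 ≤ α ^ 2 * B ^ 4 * ρ * B ^ 2 := by positivity
    nlinarith
  rw [div_pow, le_div_iff₀ (by positivity)]
  have h1 : B ^ 2 / ρ * (α * (8 * (B ^ 2 / ρ) + 4.16)) * ρ ^ 2 =
      8 * α * B ^ 4 + 4.16 * (ρ * α * B ^ 2) := by
    field_simp
  rw [h1, add_sq, ha2, hb2]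
  have : 0 ≤ ρ * α * B ^ 2 := by positivity
  linarith

/-- A net of directions fine enough for the lower tail, whose cardinality is absorbed by the
exponential bound at the burn-in time. -/
lemma exists_net_card_mul_exp_le {d : ℕ} {κ α : ℝ} (hd : 1 ≤ d) (hdκ : d ≤ κ) (hα : 0 ≤ α)
    (hdα : d ≤ Real.exp α) (hexp : d * (κ * (α * (8 * κ + 4.16))) ≤ Real.exp α) :
    ∃ G : Finset (EuclideanSpace ℝ (Fin d)),
      (∀ v, v ≠ 0 → ∃ u ∈ G, u ≠ 0 ∧ ∃ a : ℝ, a ≠ 0 ∧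
        ‖u - a • v‖ ^ 2 * κ ≤ 1 / 2500 * ‖u‖ ^ 2) ∧
      G.card * Real.exp (-(0.134 * (α * (8 * κ + 4.16)))) ≤ Real.exp (-α) := by
  have hd' : (1 : ℝ) ≤ d := by exact_mod_cast hd
  have hκ1 : 1 ≤ κ := hd'.trans hdκ
  rcases hd.eq_or_lt with rfl | hd2
  · obtain ⟨u, hu, h⟩ := exists_net_one
    refine ⟨{u}, fun v hv => ⟨u, by simp, hu, ?_⟩, ?_⟩
    · obtain ⟨a, ha, hav⟩ := h v hv
      refine ⟨a, ha, ?_⟩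
      rw [hav]
      simp
    · simp only [Finset.card_singleton, Nat.cast_one, one_mul]
      refine Real.exp_le_exp.2 ?_
      nlinarith [mul_nonneg hα (sub_nonneg.2 hκ1)]
  have hd2' : (2 : ℝ) ≤ d := by exact_mod_cast hd2
  have hκ2 : 2 ≤ κ := hd2'.trans hdκ
  have hlog2 := Real.log_two_gt_d9
  norm_num at hlog2
  have hgrow : 16 * κ ^ 2 * α ≤ Real.exp α := by
    refine le_trans ?_ hexp
    have h1 : 0 ≤ κ * (α * (8 * κ + 4.16)) := by positivity
    have h2 : 0 ≤ κ * α := by positivity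
    nlinarith
  have hlow : ∀ c : ℕ, (c : ℝ) * Real.log 2 ≤ Real.log (Real.exp α) ↔
      (2 : ℝ) ^ c ≤ Real.exp α := fun c => by
    rw [← Real.log_pow, Real.log_le_log_iff (by positivity) (Real.exp_pos _)]
  simp only [Real.log_exp] at hlow
  have hα1 : 1 * Real.log 2 ≤ α := by
    exact_mod_cast (hlow 1).2 (by simpa using hd2'.trans hdα)
  have hα5 : 5 * Real.log 2 ≤ α := by
    exact_mod_cast (hlow 5).2 (le_trans (by nlinarith) hgrow)
  have hα7 : 7 * Real.log 2 ≤ α := by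
    exact_mod_cast (hlow 7).2 (le_trans (by nlinarith) hgrow)
  have hα64 : 64 * κ ^ 2 ≤ Real.exp α := le_trans (by nlinarith [sq_nonneg κ]) hgrow
  have hlogκ : Real.log 2 ≤ Real.log κ := Real.log_le_log (by norm_num) hκ2
  have hα64' : 6 * Real.log 2 + 2 * Real.log κ ≤ α := by
    have h := Real.log_le_log (by positivity) hα64
    rw [Real.log_exp, Real.log_mul (by norm_num) (by positivity), Real.log_pow,
      show (64 : ℝ) = 2 ^ 6 by norm_num, Real.log_pow] at h
    exact_mod_cast h
  have hlog52 : 4 * Real.log 52 ≤ 23 * Real.log 2 := by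
    have h := Real.log_le_log (x := 52 ^ 4) (y := 2 ^ 23) (by norm_num) (by norm_num)
    rw [Real.log_pow, Real.log_pow] at h
    exact_mod_cast h
  have hcard : Real.log (52 * κ) ≤ 0.85 * α := by
    rw [Real.log_mul (by norm_num) (by positivity)]
    linarith
  set M := ⌈25 * κ⌉₊ with hM
  have hM1 : 25 * κ ≤ M := Nat.le_ceil _
  have hM2 : (M : ℝ) < 25 * κ + 1 := Nat.ceil_lt_add_one (by positivity)
  have hM0 : 0 < M := Nat.ceil_pos.2 (by positivity)
  obtain ⟨G, hG, hnet⟩ := exists_grid_net d M hM0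
  refine ⟨G, fun v hv => ?_, ?_⟩
  · obtain ⟨u, huG, hu, a, ha, h⟩ := hnet v hv
    refine ⟨u, huG, hu, a, ha, ?_⟩
    have h1 : (d : ℝ) / (4 * M ^ 2) * κ ≤ 1 / 2500 := by
      rw [div_mul_eq_mul_div, div_le_div_iff₀ (by positivity) (by norm_num)]
      have h2 : (25 * κ) ^ 2 ≤ (M : ℝ) ^ 2 := by gcongr
      have h3 : d * κ ≤ κ * κ := by gcongr
      nlinarith
    calc ‖u - a • v‖ ^ 2 * κ ≤ d / (4 * M ^ 2) * ‖u‖ ^ 2 * κ := by gcongr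
      _ = d / (4 * M ^ 2) * κ * ‖u‖ ^ 2 := by ring
      _ ≤ 1 / 2500 * ‖u‖ ^ 2 := by gcongr
  · have hG' : (G.card : ℝ) ≤ Real.exp (κ * (0.85 * α)) := by
      calc (G.card : ℝ) ≤ (2 * M + 1) ^ d := by exact_mod_cast hG
        _ ≤ (52 * κ) ^ d := by gcongr; linarith
        _ = Real.exp (d * Real.log (52 * κ)) := by
          rw [← Real.log_pow, Real.exp_log (by positivity)]
        _ ≤ Real.exp (κ * (0.85 * α)) := by
          have := Real.log_nonneg (x := 52 * κ) (by linarith)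
          gcongr
    calc G.card * Real.exp (-(0.134 * (α * (8 * κ + 4.16))))
        ≤ Real.exp (κ * (0.85 * α)) * Real.exp (-(0.134 * (α * (8 * κ + 4.16)))) := by gcongr
      _ = Real.exp (κ * (0.85 * α) + -(0.134 * (α * (8 * κ + 4.16)))) := (Real.exp_add _ _).symm
      _ ≤ Real.exp (-α) := by
        refine Real.exp_le_exp.2 ?_
        nlinarith [mul_nonneg hα (sub_nonneg.2 hκ2)]

lemma dotProduct_outerProd_mulVec {d : ℕ} (u x : EuclideanSpace ℝ (Fin d)) :
    u.ofLp ⬝ᵥ (outerProd x *ᵥ u.ofLp) = inner ℝ u x ^ 2 := by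
  have h : outerProd x = Matrix.vecMulVec x.ofLp x.ofLp := rfl
  rw [h, Matrix.vecMulVec_mulVec, dotProduct_smul, EuclideanSpace.inner_eq_star_dotProduct]
  simp [dotProduct_comm, sq]

lemma dotProduct_self_eq_norm_sq {d : ℕ} (u : EuclideanSpace ℝ (Fin d)) :
    u.ofLp ⬝ᵥ u.ofLp = ‖u‖ ^ 2 := by
  rw [EuclideanSpace.real_norm_sq_eq]
  simp [dotProduct, sq]

lemma integrable_apply_mul_apply {Ω : Type*} {m0 : MeasurableSpace Ω} {μ : Measure Ω}
    [IsFiniteMeasure μ] {d : ℕ} {X : Ω → EuclideanSpace ℝ (Fin d)} (hX : Measurable X) {B : ℝ}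
    (hXB : ∀ᵐ ω ∂μ, ‖X ω‖ ≤ B) (i j : Fin d) : Integrable (fun ω => X ω i * X ω j) μ := by
  refine Integrable.of_bound (by fun_prop) (B * B) ?_
  filter_upwards [hXB] with ω h
  rw [norm_mul]
  have hi := (PiLp.norm_apply_le (X ω) i).trans h
  have hj := (PiLp.norm_apply_le (X ω) j).trans h
  exact mul_le_mul hi hj (norm_nonneg _) ((norm_nonneg _).trans hi)

lemma condExp_inner_sq {Ω : Type*} {m m0 : MeasurableSpace Ω} {μ : Measure Ω}
    [IsFiniteMeasure μ] {d : ℕ} {X : Ω → EuclideanSpace ℝ (Fin d)} (hX : Measurable X) {B : ℝ}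
    (hXB : ∀ᵐ ω ∂μ, ‖X ω‖ ≤ B) (u : EuclideanSpace ℝ (Fin d)) :
    μ[fun ω => inner ℝ u (X ω) ^ 2 | m] =ᵐ[μ]
      fun ω => u.ofLp ⬝ᵥ (matCondexp μ m (fun ω' => outerProd (X ω')) ω *ᵥ u.ofLp) := by
  have hsum : (fun ω => inner ℝ u (X ω) ^ 2) =
      ∑ p : Fin d × Fin d, (u p.1 * u p.2) • fun ω => X ω p.1 * X ω p.2 := by
    ext ω
    rw [← dotProduct_outerProd_mulVec, Fintype.sum_prod_type]
    simp only [dotProduct, Matrix.mulVec, outerProd, Matrix.of_apply, Finset.mul_sum,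
      Finset.sum_apply, Pi.smul_apply, smul_eq_mul]
    exact Finset.sum_congr rfl fun i _ => Finset.sum_congr rfl fun j _ => by ring
  have h1 := condExp_finsetSum (μ := μ) (s := Finset.univ)
    (f := fun p : Fin d × Fin d => (u p.1 * u p.2) • fun ω => X ω p.1 * X ω p.2)
    (fun p _ => (integrable_apply_mul_apply hX hXB p.1 p.2).smul _) m
  have h2 : ∀ᵐ ω ∂μ, ∀ p ∈ (Finset.univ : Finset (Fin d × Fin d)),
      (μ[(u p.1 * u p.2) • fun ω => X ω p.1 * X ω p.2 | m]) ω =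
        (u p.1 * u p.2) * (μ[fun ω => X ω p.1 * X ω p.2 | m]) ω := by
    rw [Filter.eventually_all_finset]
    exact fun p _ => condExp_smul _ _ _
  rw [hsum]
  filter_upwards [h1, h2] with ω a b
  rw [a, Finset.sum_apply, Finset.sum_congr rfl b, Fintype.sum_prod_type]
  simp only [dotProduct, Matrix.mulVec, matCondexp, outerProd, Matrix.of_apply, Finset.mul_sum]
  exact Finset.sum_congr rfl fun i _ => Finset.sum_congr rfl fun j _ => by ring

/-- Taking traces in the non-degeneracy condition bounds the dimension. -/
lemma dim_mul_le_sq {Ω : Type*} {m m0 : MeasurableSpace Ω} {μ : Measure Ω}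
    [IsProbabilityMeasure μ] (hm : m ≤ m0) {d : ℕ} {X : Ω → EuclideanSpace ℝ (Fin d)}
    (hX : Measurable X) {B ρ : ℝ} (hXB : ∀ᵐ ω ∂μ, ‖X ω‖ ≤ B)
    (h : ∀ᵐ ω ∂μ, (matCondexp μ m (fun ω' => outerProd (X ω')) ω
      - ρ • (1 : Matrix (Fin d) (Fin d) ℝ)).PosSemidef) : d * ρ ≤ B ^ 2 := by
  have hi : ∀ i : Fin d, ρ ≤ ∫ ω, X ω i * X ω i ∂μ := fun i => by
    rw [← integral_condExp hm]
    calc ρ = ∫ _, ρ ∂μ := by simp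
      _ ≤ _ := by
        refine integral_mono_ae (integrable_const _) integrable_condExp ?_
        filter_upwards [h] with ω hω
        have := hω.diag_nonneg (i := i)
        simpa [matCondexp, outerProd] using this
  calc (d : ℝ) * ρ = ∑ _ : Fin d, ρ := by simp
    _ ≤ ∑ i : Fin d, ∫ ω, X ω i * X ω i ∂μ := Finset.sum_le_sum fun i _ => hi i
    _ = ∫ ω, ∑ i : Fin d, X ω i * X ω i ∂μ :=
        (integral_finsetSum _ fun i _ => integrable_apply_mul_apply hX hXB i i).symm
    _ ≤ ∫ _, B ^ 2 ∂μ := by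
        refine integral_mono_ae (integrable_finsetSum _ fun i _ =>
          integrable_apply_mul_apply hX hXB i i) (integrable_const _) ?_
        filter_upwards [hXB] with ω hω
        have h2 : ∑ i : Fin d, X ω i * X ω i = ‖X ω‖ ^ 2 := by
          rw [EuclideanSpace.real_norm_sq_eq]
          simp [sq]
        rw [h2]
        gcongr
    _ = B ^ 2 := by simp

/-- Lower-tail bound for the Gram form in a fixed direction. -/
lemma measure_sum_inner_sq_le {Ω : Type*} {m0 : MeasurableSpace Ω} {μ : Measure Ω}
    [IsProbabilityMeasure μ] (ℱ : Filtration ℕ m0) {d : ℕ} {B ρ : ℝ} (hB : 0 < B)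
    {x : ℕ → Ω → EuclideanSpace ℝ (Fin d)} {t : ℕ} (ht : 1 ≤ t)
    (hadapted : ∀ s ∈ Finset.Icc 1 t, Measurable[ℱ s] (x s))
    (hbound : ∀ s ∈ Finset.Icc 1 t, ∀ᵐ ω ∂μ, ‖x s ω‖ ≤ B)
    (hnondeg : ∀ᵐ ω ∂μ,
      (((t : ℝ)⁻¹ • ∑ s ∈ Finset.Icc 1 t, matCondexp μ (ℱ (s - 1)) (fun ω' => outerProd (x s ω')) ω)
        - ρ • (1 : Matrix (Fin d) (Fin d) ℝ)).PosSemidef)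
    {u : EuclideanSpace ℝ (Fin d)} (hu : u ≠ 0) {q : ℝ} (hq0 : 0 < q) (hq1 : q < 1) :
    μ {ω | ∑ s ∈ Finset.Icc 1 t, inner ℝ u (x s ω) ^ 2 ≤ q * (ρ * t * ‖u‖ ^ 2)} ≤
      ENNReal.ofReal (Real.exp (-(ρ * t / B ^ 2 * (q * Real.log q + 1 - q)))) := by
  have hu0 : 0 < ‖u‖ := norm_pos_iff.2 hu
  set c : ℝ := (B ^ 2 * ‖u‖ ^ 2)⁻¹ with hc
  have hc0 : 0 < c := by positivity
  have hct : c * (ρ * t * ‖u‖ ^ 2) = ρ * t / B ^ 2 := by rw [hc]; field_simp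
  have ht0 : (0 : ℝ) < t := by exact_mod_cast ht
  have hset : {ω | ∑ s ∈ Finset.Icc 1 t, inner ℝ u (x s ω) ^ 2 ≤ q * (ρ * t * ‖u‖ ^ 2)} =
      {ω | ∑ s ∈ Finset.Icc 1 t, c * inner ℝ u (x s ω) ^ 2 ≤ q * (ρ * t / B ^ 2)} := by
    ext ω
    rw [Set.mem_ofPred_eq, Set.mem_ofPred_eq, ← Finset.mul_sum, ← hct, mul_left_comm q c,
      mul_le_mul_iff_right₀ hc0]
  rw [hset]
  refine measure_sum_le_of_condExp_sum_ge ℱ hq0 hq1 t (fun s hs => ?_) (fun s hs => ?_) _ ?_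
  · have := hadapted s hs
    refine Measurable.stronglyMeasurable ?_
    exact ((this.const_inner).pow_const 2).const_mul c
  · filter_upwards [hbound s hs] with ω hω
    refine ⟨by positivity, ?_⟩
    rw [hc, inv_mul_le_one₀ (by positivity), ← sq_abs]
    calc |inner ℝ u (x s ω)| ^ 2 ≤ (‖u‖ * ‖x s ω‖) ^ 2 := by
          gcongr; exact abs_real_inner_le_norm _ _
      _ ≤ (‖u‖ * B) ^ 2 := by gcongr
      _ = B ^ 2 * ‖u‖ ^ 2 := by ring
  · have hce : ∀ᵐ ω ∂μ, ∀ s ∈ Finset.Icc 1 t,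
        (μ[fun ω => c * inner ℝ u (x s ω) ^ 2 | ℱ (s - 1)]) ω = c * (u.ofLp ⬝ᵥ
          (matCondexp μ (ℱ (s - 1)) (fun ω' => outerProd (x s ω')) ω *ᵥ u.ofLp)) := by
      rw [Filter.eventually_all_finset]
      intro s hs
      have h1 := condExp_inner_sq (m := ℱ (s - 1)) ((hadapted s hs).mono (ℱ.le s) le_rfl)
        (hbound s hs) u
      have h2 := condExp_smul (μ := μ) c (fun ω => inner ℝ u (x s ω) ^ 2) (ℱ (s - 1))
      filter_upwards [h1, h2] with ω a b
      rw [← a]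
      exact b
    filter_upwards [hce, hnondeg] with ω a b
    rw [Finset.sum_congr rfl a, ← Finset.mul_sum, ← hct, mul_le_mul_iff_right₀ hc0]
    have h := b.dotProduct_mulVec_nonneg u.ofLp
    simp only [star_trivial, Matrix.sub_mulVec, Matrix.smul_mulVec, Matrix.one_mulVec,
      Matrix.sum_mulVec, dotProduct_sub, dotProduct_smul, dotProduct_sum, smul_eq_mul,
      dotProduct_self_eq_norm_sq, sub_nonneg] at h
    rw [le_inv_mul_iff₀ ht0] at h
    linarith

/-- A direction witnessing that the shifted regularized Gram matrix is not positive
semidefinite. -/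
lemma exists_sum_inner_sq_lt_of_not_posSemidef {d : ℕ} (n : ℕ)
    (x : ℕ → EuclideanSpace ℝ (Fin d)) {lam r : ℝ}
    (h : ¬ ((lam • (1 : Matrix (Fin d) (Fin d) ℝ) + ∑ s ∈ Finset.Icc 1 n, outerProd (x s))
      - (lam + r) • (1 : Matrix (Fin d) (Fin d) ℝ)).PosSemidef) :
    ∃ v : EuclideanSpace ℝ (Fin d), ∑ s ∈ Finset.Icc 1 n, inner ℝ v (x s) ^ 2 < r * ‖v‖ ^ 2 := by
  by_contra! hv
  refine h (Matrix.PosSemidef.of_dotProduct_mulVec_nonneg ?_ fun w => ?_)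
  · ext i j
    simp [Matrix.sum_apply, outerProd, Matrix.one_apply, eq_comm, mul_comm]
  · have h := hv (WithLp.toLp 2 w)
    simp only [← dotProduct_outerProd_mulVec, ← dotProduct_self_eq_norm_sq] at h
    simp only [star_trivial, Matrix.sub_mulVec, Matrix.add_mulVec, Matrix.smul_mulVec,
      Matrix.one_mulVec, Matrix.sum_mulVec, dotProduct_sub, dotProduct_add, dotProduct_smul,
      dotProduct_sum, smul_eq_mul]
    linarith

/-- High-probability lower bound on the smallest eigenvalue of the regularized
Gram matrix.  `(x_t)_{t=1}^T` is adapted to the filtration `(ℱ_t)`, bounded by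
`B` a.s., and satisfies the non-degeneracy condition
`(1/t) Σ_{s=1}^t E[x_s x_sᵀ | ℱ_{s−1}] ⪰ ρ I` a.s. for each `1 ≤ t ≤ T`.
With `α = log(dT/δ)` and
`T₀ = ⌈((B²√(2α) + B√(2B²α + 8ρα/3))/ρ)²⌉`, with probability at least `1 − δ`,
for all `T₀ ≤ t ≤ T` one has
`λ_min(λI + Σ_{s=1}^t x_s x_sᵀ) ≥ λ + ρt/2` (expressed in the PSD order). -/
theorem stmt3 {Ω : Type*} {m0 : MeasurableSpace Ω} (μ : Measure Ω)
    [IsProbabilityMeasure μ] (ℱ : Filtration ℕ m0)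
    (d T : ℕ) (B ρ lam δ : ℝ) (hB : 0 < B) (hρ : 0 < ρ)
    (hlam : 0 < lam) (hδ : δ ∈ Set.Ioo (0 : ℝ) 1)
    (x : ℕ → Ω → EuclideanSpace ℝ (Fin d))
    (hadapted : ∀ t ∈ Finset.Icc 1 T, Measurable[ℱ t] (x t))
    (hbound : ∀ t ∈ Finset.Icc 1 T, ∀ᵐ ω ∂μ, ‖x t ω‖ ≤ B)
    (hnondeg : ∀ t ∈ Finset.Icc 1 T, ∀ᵐ ω ∂μ,
      (((t : ℝ)⁻¹ • ∑ s ∈ Finset.Icc 1 t, matCondexp μ (ℱ (s - 1)) (fun ω' => outerProd (x s ω')) ω)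
        - ρ • (1 : Matrix (Fin d) (Fin d) ℝ)).PosSemidef)
    (α : ℝ) (hα : α = Real.log (d * T / δ))
    (T₀ : ℕ)
    (hT₀ : T₀ = ⌈((B ^ 2 * Real.sqrt (2 * α)
        + B * Real.sqrt (2 * B ^ 2 * α + 8 * ρ * α / 3)) / ρ) ^ 2⌉₊) :
    ENNReal.ofReal (1 - δ) ≤
      μ {ω | ∀ t, T₀ ≤ t → t ≤ T →
        ((lam • (1 : Matrix (Fin d) (Fin d) ℝ)
            + ∑ s ∈ Finset.Icc 1 t, outerProd (x s ω))
          - (lam + ρ * t / 2) • (1 : Matrix (Fin d) (Fin d) ℝ)).PosSemidef} := by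
  classical
  have huniv : (∀ ω, ∀ t, T₀ ≤ t → t ≤ T →
        ((lam • (1 : Matrix (Fin d) (Fin d) ℝ)
            + ∑ s ∈ Finset.Icc 1 t, outerProd (x s ω))
          - (lam + ρ * t / 2) • (1 : Matrix (Fin d) (Fin d) ℝ)).PosSemidef) →
      ENNReal.ofReal (1 - δ) ≤
      μ {ω | ∀ t, T₀ ≤ t → t ≤ T →
        ((lam • (1 : Matrix (Fin d) (Fin d) ℝ)
            + ∑ s ∈ Finset.Icc 1 t, outerProd (x s ω))
          - (lam + ρ * t / 2) • (1 : Matrix (Fin d) (Fin d) ℝ)).PosSemidef} := by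
    intro h
    have hset := Set.eq_univ_of_forall (s := {ω | ∀ t, T₀ ≤ t → t ≤ T →
        ((lam • (1 : Matrix (Fin d) (Fin d) ℝ)
            + ∑ s ∈ Finset.Icc 1 t, outerProd (x s ω))
          - (lam + ρ * t / 2) • (1 : Matrix (Fin d) (Fin d) ℝ)).PosSemidef}) h
    rw [hset, measure_univ]
    exact ENNReal.ofReal_le_one.2 (by linarith [hδ.1])
  rcases Nat.eq_zero_or_pos d with rfl | hd
  · refine huniv fun ω t _ _ => ?_
    rw [Subsingleton.elim (_ - _ : Matrix (Fin 0) (Fin 0) ℝ) 0]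
    exact Matrix.PosSemidef.zero
  rcases Nat.eq_zero_or_pos T with rfl | hT
  · refine huniv fun ω t _ ht => ?_
    obtain rfl : t = 0 := by omega
    simpa using Matrix.PosSemidef.zero
  rcases lt_or_ge T T₀ with hTT | hTT
  · exact huniv fun ω t h1 h2 => by omega
  have hd1 : (1 : ℝ) ≤ d := by exact_mod_cast hd
  have hT1 : (1 : ℝ) ≤ T := by exact_mod_cast hT
  have hdT : (d : ℝ) * T ≤ d * T / δ := by
    rw [le_div_iff₀ hδ.1]
    exact mul_le_of_le_one_right (by positivity) hδ.2.le
  have hexpα : Real.exp α = d * T / δ := by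
    rw [hα, Real.exp_log (div_pos (by positivity) hδ.1)]
  have hα0 : 0 ≤ α := by
    rw [hα]
    exact Real.log_nonneg ((one_le_mul_of_one_le_of_one_le hd1 hT1).trans hdT)
  have hm : ∀ s ∈ Finset.Icc 1 T, Measurable (x s) := fun s hs =>
    (hadapted s hs).mono (ℱ.le s) le_rfl
  have h1mem : 1 ∈ Finset.Icc 1 T := Finset.mem_Icc.2 ⟨le_rfl, hT⟩
  have hdim : d * ρ ≤ B ^ 2 := by
    refine dim_mul_le_sq (ℱ.le 0) (hm 1 h1mem) (hbound 1 h1mem) ?_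
    filter_upwards [hnondeg 1 h1mem] with ω h
    simpa using h
  set κ := B ^ 2 / ρ with hκ
  have hdκ : d ≤ κ := (le_div_iff₀ hρ).2 hdim
  have hκ0 : 0 < κ := by positivity
  have hT₀' : κ * (α * (8 * κ + 4.16)) ≤ T₀ := by
    rw [hT₀]
    refine (burn_in_lower_bound hB hρ ?_ hα0).trans (Nat.le_ceil _)
    exact (le_mul_of_one_le_left hρ.le hd1).trans hdim
  have hTT' : (T₀ : ℝ) ≤ T := by exact_mod_cast hTT
  obtain ⟨G, hnet, hcard⟩ := exists_net_card_mul_exp_le hd hdκ hα0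
    (by rw [hexpα]; exact (le_mul_of_one_le_right (by positivity) hT1).trans hdT)
    (by
      rw [hexpα]
      exact (mul_le_mul_of_nonneg_left (hT₀'.trans hTT') (by positivity)).trans hdT)
  set R := 0.134 * (α * (8 * κ + 4.16)) with hR
  set I := (Finset.Icc 1 T).filter (T₀ ≤ ·) with hI
  set E : ℕ → EuclideanSpace ℝ (Fin d) → Set Ω := fun t u =>
    {ω | ∑ s ∈ Finset.Icc 1 t, inner ℝ u (x s ω) ^ 2 ≤ 0.529 * (ρ * t * ‖u‖ ^ 2)} with hE
  have hsubset : ∀ t ∈ Finset.Icc 1 T, ∀ s ∈ Finset.Icc 1 t, s ∈ Finset.Icc 1 T :=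
    fun t ht s hs => by simp only [Finset.mem_Icc] at ht hs ⊢; omega
  have hEle : ∀ t ∈ I, ∀ u ∈ G.filter (· ≠ 0), μ (E t u) ≤ ENNReal.ofReal (Real.exp (-R)) := by
    intro t ht u hu
    obtain ⟨htT, hT₀t⟩ := Finset.mem_filter.1 ht
    have hT₀t' : (T₀ : ℝ) ≤ t := by exact_mod_cast hT₀t
    refine (measure_sum_inner_sq_le ℱ hB (Finset.mem_Icc.1 htT).1
      (fun s hs => hadapted s (hsubset t htT s hs)) (fun s hs => hbound s (hsubset t htT s hs))
      (hnondeg t htT) (Finset.mem_filter.1 hu).2 (by norm_num) (by norm_num)).trans ?_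
    refine ENNReal.ofReal_le_ofReal (Real.exp_le_exp.2 (neg_le_neg ?_))
    have h1 : ρ * t / B ^ 2 = t / κ := by rw [hκ]; field_simp
    have h2 : α * (8 * κ + 4.16) ≤ t / κ := by
      rw [le_div_iff₀ hκ0]; linarith
    rw [h1, hR, mul_comm (0.134 : ℝ)]
    exact mul_le_mul h2 chernoff_rate_bound (by norm_num) (by positivity)
  set A := {ω | ∀ t, T₀ ≤ t → t ≤ T →
        ((lam • (1 : Matrix (Fin d) (Fin d) ℝ)
            + ∑ s ∈ Finset.Icc 1 t, outerProd (x s ω))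
          - (lam + ρ * t / 2) • (1 : Matrix (Fin d) (Fin d) ℝ)).PosSemidef} with hA
  have hcover : μ Aᶜ ≤ μ (⋃ t ∈ I, ⋃ u ∈ G.filter (· ≠ 0), E t u) := by
    have hball : ∀ᵐ ω ∂μ, ∀ s ∈ Finset.Icc 1 T, ‖x s ω‖ ≤ B :=
      (Filter.eventually_all_finset _).2 hbound
    refine measure_mono_ae ?_
    filter_upwards [hball] with ω hω (hωA : ω ∉ A)
    rw [hA, Set.mem_ofPred_eq] at hωA
    push Not at hωA
    obtain ⟨t, hT₀t, htT, hpsd⟩ := hωA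
    obtain ⟨v, hv⟩ := exists_sum_inner_sq_lt_of_not_posSemidef t (fun s => x s ω) hpsd
    have hv0 : v ≠ 0 := by
      rintro rfl
      simp at hv
    have ht1 : 1 ≤ t := by
      by_contra! h
      obtain rfl : t = 0 := by omega
      simp at hv
    have htI : t ∈ Finset.Icc 1 T := Finset.mem_Icc.2 ⟨ht1, htT⟩
    obtain ⟨u, huG, hu, a, ha, hua⟩ := hnet v hv0
    have hmem : ω ∈ E t u := by
      refine sum_inner_sq_le_of_near t (fun s => x s ω)
        (fun s hs => hω s (hsubset t htI s hs)) (smul_ne_zero ha hv0) ?_ ?_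
      · calc ‖u - a • v‖ ^ 2 * B ^ 2 = ρ * (‖u - a • v‖ ^ 2 * κ) := by rw [hκ]; field_simp
          _ ≤ ρ * (1 / 2500 * ‖u‖ ^ 2) := by gcongr
          _ = 1 / 2500 * ρ * ‖u‖ ^ 2 := by ring
      · calc ∑ s ∈ Finset.Icc 1 t, inner ℝ (a • v) (x s ω) ^ 2
            = a ^ 2 * ∑ s ∈ Finset.Icc 1 t, inner ℝ v (x s ω) ^ 2 := by
              rw [Finset.mul_sum]
              refine Finset.sum_congr rfl fun s _ => ?_
              rw [real_inner_smul_left, mul_pow]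
          _ ≤ a ^ 2 * (ρ * t / 2 * ‖v‖ ^ 2) := by gcongr
          _ = ρ * t / 2 * ‖a • v‖ ^ 2 := by
              rw [norm_smul, mul_pow, Real.norm_eq_abs, sq_abs]; ring
    exact Set.mem_biUnion (Finset.mem_filter.2 ⟨htI, hT₀t⟩)
      (Set.mem_biUnion (Finset.mem_filter.2 ⟨huG, hu⟩) hmem)
  have hbad : μ Aᶜ ≤ ENNReal.ofReal δ := by
    calc μ Aᶜ ≤ ∑ t ∈ I, ∑ u ∈ G.filter (· ≠ 0), μ (E t u) :=
          hcover.trans <| (measure_biUnion_finset_le _ _).trans <|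
            Finset.sum_le_sum fun t _ => measure_biUnion_finset_le _ _
      _ ≤ ∑ t ∈ I, ∑ u ∈ G.filter (· ≠ 0), ENNReal.ofReal (Real.exp (-R)) :=
          Finset.sum_le_sum fun t ht => Finset.sum_le_sum fun u hu => hEle t ht u hu
      _ = ENNReal.ofReal (I.card * ((G.filter (· ≠ 0)).card * Real.exp (-R))) := by
          rw [ENNReal.ofReal_mul (by positivity), ENNReal.ofReal_mul (by positivity)]
          simp
      _ ≤ ENNReal.ofReal δ := by
          refine ENNReal.ofReal_le_ofReal ?_
          have hIT : (I.card : ℝ) ≤ T := by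
            have := Finset.card_filter_le (Finset.Icc 1 T) (T₀ ≤ ·)
            rw [Nat.card_Icc, Nat.add_sub_cancel] at this
            exact_mod_cast this
          have hGG : ((G.filter (· ≠ 0)).card : ℝ) ≤ G.card := by
            exact_mod_cast Finset.card_filter_le _ _
          calc (I.card : ℝ) * ((G.filter (· ≠ 0)).card * Real.exp (-R))
              ≤ T * (G.card * Real.exp (-R)) := by gcongr
            _ ≤ T * Real.exp (-α) := by gcongr
            _ = δ / d := by
              have := hδ.1
              rw [Real.exp_neg, hexpα]
              field_simp
            _ ≤ δ := div_le_self hδ.1.le hd1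
  have htotal : 1 ≤ μ A + μ Aᶜ := by
    rw [← measure_univ (μ := μ), ← Set.union_compl_self A]
    exact measure_union_le _ _
  rw [ENNReal.ofReal_sub _ hδ.1.le, ENNReal.ofReal_one, tsub_le_iff_right]
  exact htotal.trans (by gcongr)
end

section
/- Let x_1, …, x_t ∈ ℝ^d satisfy |x_s| ≤ B for all 1 ≤ s ≤ t, and let λ > 0. Then det( λI + Σ_{s=1}^t x_s x_sᵀ ) ≤ (λ + tB²/d)^d. -/
open Matrix

/-- The arithmetic-geometric mean inequality over a finite index type, with the roots cleared. -/
theorem prod_le_sum_div_card_pow {ι : Type*} [Fintype ι] (z : ι → ℝ) (hz : ∀ i, 0 ≤ z i) :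
    ∏ i, z i ≤ ((∑ i, z i) / Fintype.card ι) ^ Fintype.card ι := by
  rcases isEmpty_or_nonempty ι with _ | _
  · simp
  have hcard : (Fintype.card ι : ℝ) ≠ 0 := by
    exact_mod_cast Fintype.card_ne_zero
  have amgm := Real.geom_mean_le_arith_mean_weighted Finset.univ
    (fun _ : ι => (Fintype.card ι : ℝ)⁻¹) z (fun _ _ => by positivity)
    (by simp [hcard]) (fun i _ => hz i)
  rw [Real.finsetProd_rpow _ _ (fun i _ => hz i), ← Finset.mul_sum, inv_mul_eq_div] at amgm
  have hprod : 0 ≤ ∏ i, z i := Finset.prod_nonneg fun i _ => hz i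
  calc ∏ i, z i = ((∏ i, z i) ^ (Fintype.card ι : ℝ)⁻¹) ^ Fintype.card ι :=
        (Real.rpow_inv_natCast_pow hprod Fintype.card_ne_zero).symm
    _ ≤ _ := pow_le_pow_left₀ (Real.rpow_nonneg hprod _) amgm _

/-- The determinant of a positive semidefinite real matrix is bounded by a power of its
normalized trace. -/
theorem Matrix.PosSemidef.det_le_trace_div_card_pow {n : Type*} [Fintype n] [DecidableEq n]
    {A : Matrix n n ℝ} (hA : A.PosSemidef) :
    A.det ≤ (A.trace / Fintype.card n) ^ Fintype.card n := by
  rw [hA.isHermitian.det_eq_prod_eigenvalues, hA.isHermitian.trace_eq_sum_eigenvalues]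
  exact prod_le_sum_div_card_pow _ hA.eigenvalues_nonneg

/-- Determinant–trace bound: if `x_1, …, x_t ∈ ℝ^d` satisfy `|x_s| ≤ B` and
`λ > 0`, then `det(λI + Σ_s x_s x_sᵀ) ≤ (λ + tB²/d)^d`. -/
theorem stmt8 (d t : ℕ) (B lam : ℝ) (hlam : 0 < lam)
    (x : Fin t → EuclideanSpace ℝ (Fin d))
    (hx : ∀ s, ‖x s‖ ≤ B) :
    (lam • (1 : Matrix (Fin d) (Fin d) ℝ)
        + ∑ s : Fin t, Matrix.of fun i j => x s i * x s j).det
      ≤ (lam + t * B ^ 2 / d) ^ d := by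
  rcases Nat.eq_zero_or_pos d with rfl | hd
  · simp
  have hpsd : (lam • (1 : Matrix (Fin d) (Fin d) ℝ)
      + ∑ s : Fin t, Matrix.of fun i j => x s i * x s j).PosSemidef := by
    refine (PosSemidef.one.smul hlam.le).add (posSemidef_sum _ fun s _ => ?_)
    exact posSemidef_vecMulVec_self_star (x s : Fin d → ℝ)
  have htrace_outer (s : Fin t) :
      (Matrix.of fun i j => x s i * x s j : Matrix (Fin d) (Fin d) ℝ).trace ≤ B ^ 2 := by
    calc _ = ‖x s‖ ^ 2 := by
          rw [EuclideanSpace.real_norm_sq_eq]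
          simp [Matrix.trace, sq]
      _ ≤ B ^ 2 := pow_le_pow_left₀ (norm_nonneg _) (hx s) 2
  have htrace : (lam • (1 : Matrix (Fin d) (Fin d) ℝ)
      + ∑ s : Fin t, Matrix.of fun i j => x s i * x s j).trace ≤ lam * d + t * B ^ 2 := by
    rw [trace_add, trace_smul, trace_one, trace_sum, Fintype.card_fin, smul_eq_mul]
    gcongr
    simpa using Finset.sum_le_sum fun s (_ : s ∈ Finset.univ) => htrace_outer s
  have hd' : (0 : ℝ) < d := by exact_mod_cast hd
  refine hpsd.det_le_trace_div_card_pow.trans ?_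
  rw [Fintype.card_fin]
  refine pow_le_pow_left₀ (div_nonneg hpsd.trace_nonneg hd'.le) ?_ d
  calc _ ≤ (lam * d + t * B ^ 2) / d := by gcongr
    _ = lam + t * B ^ 2 / d := by field_simp
end

section
/- (Elliptical potential lemma.) Let (x_t)_{t≥1} be a sequence in ℝ^d with |x_t| ≤ B for all t, and let V ∈ ℝ^{d×d} be a symmetric positive definite matrix with λ_min(V) ≥ max(1, B²). Define V̄_t := V + Σ_{s=1}^t x_s x_sᵀ (so V̄_0 = V). Then for every n ∈ ℕ, Σ_{t=1}^n ‖x_t‖²_{V̄_{t−1}^{−1}} ≤ 2 log( det(V̄_n) / det(V) ). -/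
open Matrix

section RankOne

variable {ι : Type*} [Fintype ι] [DecidableEq ι]

theorem Matrix.det_add_vecMulVec_self {M : Matrix ι ι ℝ} (hM : IsUnit M.det) (u : ι → ℝ) :
    (M + vecMulVec u u).det = M.det * (1 + u ⬝ᵥ M⁻¹ *ᵥ u) := by
  rw [vecMulVec_eq Unit, det_add_replicateCol_mul_replicateRow hM]
  congr 1
  rw [det_unique, Matrix.mul_assoc, ← replicateCol_mulVec]
  rfl

theorem Matrix.PosSemidef.dotProduct_inv_mulVec_le_one {M : Matrix ι ι ℝ} {c : ℝ}
    (hdet : IsUnit M.det) (hM : (M - c • (1 : Matrix ι ι ℝ)).PosSemidef) {u : ι → ℝ}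
    (hu : u ⬝ᵥ u ≤ c) : u ⬝ᵥ M⁻¹ *ᵥ u ≤ 1 := by
  set y := M⁻¹ *ᵥ u with hy
  have hMy : M *ᵥ y = u := by
    rw [hy, mulVec_mulVec, mul_nonsing_inv _ hdet, one_mulVec]
  have h₁ : c * (y ⬝ᵥ y) ≤ u ⬝ᵥ y := by
    have h := hM.dotProduct_mulVec_nonneg y
    rw [sub_mulVec, hMy, smul_mulVec, one_mulVec, dotProduct_sub, dotProduct_smul] at h
    simp only [star_trivial, smul_eq_mul, dotProduct_comm y u] at h
    linarith
  have h₂ : (u ⬝ᵥ y) ^ 2 ≤ (u ⬝ᵥ u) * (y ⬝ᵥ y) := by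
    simpa only [dotProduct, ← sq] using Finset.sum_mul_sq_le_sq_mul_sq Finset.univ u y
  have h₃ : 0 ≤ y ⬝ᵥ y := dotProduct_self_star_nonneg y
  nlinarith [mul_le_mul_of_nonneg_right hu h₃]

end RankOne

theorem Real.le_two_mul_log_one_add {q : ℝ} (h₀ : 0 ≤ q) (h₁ : q ≤ 1) :
    q ≤ 2 * Real.log (1 + q) := by
  have h := Real.one_sub_inv_le_log_of_pos (show 0 < 1 + q by linarith)
  have h' : q / 2 ≤ 1 - (1 + q)⁻¹ := by
    rw [← sub_nonneg]
    have : 1 - (1 + q)⁻¹ - q / 2 = q * (1 - q) / (2 * (1 + q)) := by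
      field_simp
      ring
    rw [this]
    exact div_nonneg (mul_nonneg h₀ (by linarith)) (by linarith)
  linarith


open Matrix

/-- Elliptical potential lemma: let `(x_t)_{t≥1}` be vectors in `ℝ^d` with
`|x_t| ≤ B`, and let `V` be symmetric positive definite with
`λ_min(V) ≥ max(1, B²)` (expressed as `V − max(1,B²)·I ⪰ 0`).  With
`V̄_t = V + Σ_{s=1}^t x_s x_sᵀ`, for every `n`,
`Σ_{t=1}^n ‖x_t‖²_{V̄_{t−1}⁻¹} ≤ 2 log(det V̄_n / det V)`. -/
theorem stmt9 (d : ℕ) (B : ℝ)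
    (x : ℕ → EuclideanSpace ℝ (Fin d))
    (hx : ∀ t, ‖x t‖ ≤ B)
    (V : Matrix (Fin d) (Fin d) ℝ) (hV : V.PosDef)
    (hVmin : (V - max 1 (B ^ 2) • (1 : Matrix (Fin d) (Fin d) ℝ)).PosSemidef)
    (Vbar : ℕ → Matrix (Fin d) (Fin d) ℝ)
    (hVbar : ∀ t, Vbar t
      = V + ∑ s ∈ Finset.Icc 1 t, Matrix.of fun i j => x s i * x s j) :
    ∀ n : ℕ,
      ∑ t ∈ Finset.Icc 1 n, (x t) ⬝ᵥ ((Vbar (t - 1))⁻¹).mulVec (x t)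
        ≤ 2 * Real.log ((Vbar n).det / V.det) := by
  have hstep (t : ℕ) : Vbar (t + 1) = Vbar t + vecMulVec (x (t + 1)) (x (t + 1)) := by
    rw [hVbar, hVbar, Finset.sum_Icc_succ_top (by omega), ← add_assoc]
    rfl
  have hzero : Vbar 0 = V := by simp [hVbar]
  have hrank (t : ℕ) : (vecMulVec (x t) (x t) : Matrix (Fin d) (Fin d) ℝ).PosSemidef := by
    simpa using posSemidef_vecMulVec_self_star (x t).ofLp
  have hpos (t : ℕ) : (Vbar t).PosDef := by
    induction t with
    | zero => rwa [hzero]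
    | succ t ih => rw [hstep]; exact ih.add_posSemidef (hrank _)
  have hmin (t : ℕ) :
      (Vbar t - max 1 (B ^ 2) • (1 : Matrix (Fin d) (Fin d) ℝ)).PosSemidef := by
    induction t with
    | zero => rwa [hzero]
    | succ t ih => rw [hstep, add_sub_right_comm]; exact ih.add (hrank _)
  have hnorm (t : ℕ) : (x t).ofLp ⬝ᵥ (x t).ofLp ≤ max 1 (B ^ 2) := by
    have h : (x t).ofLp ⬝ᵥ (x t).ofLp = ‖x t‖ ^ 2 := by
      rw [EuclideanSpace.real_norm_sq_eq]
      simp only [dotProduct, sq]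
    rw [h]
    exact (pow_le_pow_left₀ (norm_nonneg _) (hx t) 2).trans (le_max_right _ _)
  intro n
  induction n with
  | zero => simp [hzero, hV.det_pos.ne']
  | succ n ih =>
    have hdet := (hpos n).det_pos
    set q := (x (n + 1)).ofLp ⬝ᵥ (Vbar n)⁻¹ *ᵥ (x (n + 1)).ofLp with hq
    have hq₀ : 0 ≤ q := by
      simpa using (hpos n).inv.posSemidef.dotProduct_mulVec_nonneg (x (n + 1)).ofLp
    have hq₁ : q ≤ 1 := (hmin n).dotProduct_inv_mulVec_le_one hdet.ne'.isUnit (hnorm _)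
    have hlog : Real.log ((Vbar (n + 1)).det / V.det)
        = Real.log ((Vbar n).det / V.det) + Real.log (1 + q) := by
      rw [hstep, det_add_vecMulVec_self hdet.ne'.isUnit, mul_div_right_comm,
        Real.log_mul (div_pos hdet hV.det_pos).ne' (by positivity)]
    rw [Finset.sum_Icc_succ_top (by omega), hlog, Nat.add_sub_cancel, mul_add]
    exact add_le_add ih (Real.le_two_mul_log_one_add hq₀ hq₁)
end
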